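/- Every nonzero element y of the dual lattice Γ* (equivalently, every ∑_{s=1}^{n} δ_s·A*_s with δ ∈ ℤⁿ, δ ≠ 0) satisfies ‖y‖² ≥ 2/R²; moreover, the minimum of ‖y‖² over nonzero y ∈ Γ* equals 2/R² if and only if at least two components of the (n+1)-tuple (1, a₂, …, a_{n+1}) are equal. (This is the key content of the first-eigenvalue estimate λ₁ ≥ 2/r² for the flat torus Π/Γ with R = 2πr, since λ₁ = 4π²·min{‖y‖² : y ∈ Γ*∖{0}}.) -/

import Mathlib

/-- The `k`-th coordinate of the primitive normal vector `(1, a₂, …, a_{n+1})`. -/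
def normalCoord (a : ℕ → ℕ) (k : ℕ) : ℕ := if k = 1 then 1 else a k

/-- The `k`-th coordinate of the integer vector `R • A*_s`, orthogonal to the normal vector. -/
def dualRow (n : ℕ) (a : ℕ → ℕ) (s k : ℕ) : ℤ :=
  if k = 1 then (a (n + 1 - s) : ℤ) - a (n + 2 - s)
  else (if k = n + 2 - s then 1 else 0) - (if k = n + 1 - s then 1 else 0)

/-- The `k`-th coordinate of the integer vector `R • ∑ δ_s A*_s`. -/
def dualVec (n : ℕ) (a : ℕ → ℕ) (δ : ℕ → ℤ) (k : ℕ) : ℤ :=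
  ∑ s ∈ Finset.Icc 1 n, δ s * dualRow n a s k

theorem sum_fin_succ_eq_sum_Icc {M : Type*} [AddCommMonoid M] (n : ℕ) (f : ℕ → M) :
    ∑ j : Fin (n + 1), f ((j : ℕ) + 1) = ∑ k ∈ Finset.Icc 1 (n + 1), f k := by
  rw [Fin.sum_univ_eq_sum_range (fun j => f (j + 1)) (n + 1), Finset.range_eq_Ico,
    Finset.sum_Ico_add' f 0 (n + 1) 1]
  rfl

theorem sum_Icc_one_eq_add {M : Type*} [AddCommMonoid M] (n : ℕ) (f : ℕ → M) :
    ∑ k ∈ Finset.Icc 1 (n + 1), f k = f 1 + ∑ k ∈ Finset.Icc 2 (n + 1), f k :=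
  (Finset.add_sum_Ioc_eq_sum_Icc (by omega)).symm

theorem dualRow_orthogonal {n : ℕ} {a : ℕ → ℕ} (ha1 : a 1 = 0) {s : ℕ} (hs : 1 ≤ s)
    (hsn : s ≤ n) :
    ∑ k ∈ Finset.Icc 1 (n + 1), (normalCoord a k : ℤ) * dualRow n a s k = 0 := by
  rw [sum_Icc_one_eq_add]
  have h : ∀ k ∈ Finset.Icc 2 (n + 1), (normalCoord a k : ℤ) * dualRow n a s k
      = (if k = n + 2 - s then (a k : ℤ) else 0) - (if k = n + 1 - s then (a k : ℤ) else 0) := by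
    intro k hk
    have hk1 : k ≠ 1 := by have := (Finset.mem_Icc.1 hk).1; omega
    simp only [normalCoord, dualRow, if_neg hk1]
    split_ifs <;> simp
  rw [Finset.sum_congr rfl h, Finset.sum_sub_distrib, Finset.sum_ite_eq', Finset.sum_ite_eq',
    if_pos (by simp; omega)]
  simp only [normalCoord, dualRow, if_true]
  rcases hsn.lt_or_eq with h' | rfl
  · rw [if_pos (by simp; omega)]; push_cast; ring
  · simp [ha1]

theorem dualVec_orthogonal {n : ℕ} {a : ℕ → ℕ} (ha1 : a 1 = 0) (δ : ℕ → ℤ) :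
    ∑ k ∈ Finset.Icc 1 (n + 1), (normalCoord a k : ℤ) * dualVec n a δ k = 0 := by
  simp only [dualVec, Finset.mul_sum]
  rw [Finset.sum_comm]
  refine Finset.sum_eq_zero fun s hs => ?_
  rw [Finset.mem_Icc] at hs
  have := dualRow_orthogonal ha1 hs.1 hs.2
  calc _ = δ s * ∑ k ∈ Finset.Icc 1 (n + 1), (normalCoord a k : ℤ) * dualRow n a s k := by
        rw [Finset.mul_sum]; exact Finset.sum_congr rfl fun _ _ => by ring
    _ = 0 := by rw [this, mul_zero]

theorem dualVec_of_two_le {n : ℕ} {a : ℕ → ℕ} (δ : ℕ → ℤ) {k : ℕ} (hk : 2 ≤ k)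
    (hkn : k ≤ n + 1) :
    dualVec n a δ k = δ (n + 2 - k) - if k ≤ n then δ (n + 1 - k) else 0 := by
  have h : ∀ s ∈ Finset.Icc 1 n, δ s * dualRow n a s k
      = (if s = n + 2 - k then δ s else 0) - (if s = n + 1 - k then δ s else 0) := by
    intro s hs
    rw [Finset.mem_Icc] at hs
    have h1 : (k = n + 2 - s) = (s = n + 2 - k) := propext (by omega)
    have h2 : (k = n + 1 - s) = (s = n + 1 - k) := propext (by omega)
    simp only [dualRow, if_neg (show k ≠ 1 by omega), h1, h2]
    split_ifs <;> simp
  rw [dualVec, Finset.sum_congr rfl h, Finset.sum_sub_distrib, Finset.sum_ite_eq',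
    Finset.sum_ite_eq', if_pos (by simp; omega)]
  congr 1
  refine if_congr ?_ rfl rfl
  simp; omega

theorem exists_dualVec_ne_zero {n : ℕ} {a : ℕ → ℕ} {δ : ℕ → ℤ}
    (hδ : ∃ s, 1 ≤ s ∧ s ≤ n ∧ δ s ≠ 0) :
    ∃ k ∈ Finset.Icc 1 (n + 1), dualVec n a δ k ≠ 0 := by
  by_contra! h
  obtain ⟨s, hs1, hsn, hs⟩ := hδ
  refine hs ?_
  induction s, hs1 using Nat.le_induction with
  | base =>
    have h1 := h (n + 1) (by simp)
    rw [dualVec_of_two_le δ (by omega) le_rfl] at h1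
    simpa using h1
  | succ s hs1 ih =>
    have h0 : δ s = 0 := by
      by_contra h0
      exact h0 (ih (by omega) h0)
    have h1 := h (n + 1 - s) (by simp; omega)
    rw [dualVec_of_two_le δ (by omega) (by omega), if_pos (by omega),
      show n + 2 - (n + 1 - s) = s + 1 by omega, show n + 1 - (n + 1 - s) = s by omega, h0] at h1
    simpa using h1

/-- A nonzero integer vector orthogonal to a vector without zero coordinates has two nonzero
coordinates. -/
theorem exists_pair_ne_zero_of_sum_mul_eq_zero {ι : Type*} [DecidableEq ι] {I : Finset ι}
    {v m : ι → ℤ} (hv : ∀ i ∈ I, v i ≠ 0) (horth : ∑ i ∈ I, v i * m i = 0)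
    (hm : ∃ i ∈ I, m i ≠ 0) :
    ∃ i ∈ I, ∃ j ∈ I, i ≠ j ∧ m i ≠ 0 ∧ m j ≠ 0 := by
  obtain ⟨i, hi, hmi⟩ := hm
  by_contra! h
  rw [Finset.sum_eq_single_of_mem i hi
    fun j hj hji => by rw [h i hi j hj hji.symm hmi, mul_zero]] at horth
  exact mul_ne_zero (hv i hi) hmi horth

theorem sum_eq_add_add_sum_erase {ι : Type*} [DecidableEq ι] {I : Finset ι} (f : ι → ℤ)
    {i j : ι} (hi : i ∈ I) (hj : j ∈ I) (hij : i ≠ j) :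
    ∑ k ∈ I, f k = f i + (f j + ∑ k ∈ (I.erase i).erase j, f k) := by
  rw [Finset.add_sum_erase _ _ (Finset.mem_erase.2 ⟨hij.symm, hj⟩), Finset.add_sum_erase _ _ hi]

theorem two_le_sum_sq_of_orthogonal {ι : Type*} [DecidableEq ι] {I : Finset ι}
    {v m : ι → ℤ} (hv : ∀ i ∈ I, v i ≠ 0) (horth : ∑ i ∈ I, v i * m i = 0)
    (hm : ∃ i ∈ I, m i ≠ 0) : 2 ≤ ∑ i ∈ I, m i ^ 2 := by
  obtain ⟨i, hi, j, hj, hij, hmi, hmj⟩ := exists_pair_ne_zero_of_sum_mul_eq_zero hv horth hm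
  rw [sum_eq_add_add_sum_erase (fun k => m k ^ 2) hi hj hij]
  have h1 : 0 < m i ^ 2 := by positivity
  have h2 : 0 < m j ^ 2 := by positivity
  have h3 : 0 ≤ ∑ k ∈ (I.erase i).erase j, m k ^ 2 := Finset.sum_nonneg fun _ _ => sq_nonneg _
  omega

theorem exists_eq_of_sum_sq_eq_two {ι : Type*} [DecidableEq ι] {I : Finset ι}
    {v m : ι → ℤ} (hv : ∀ i ∈ I, 0 < v i) (horth : ∑ i ∈ I, v i * m i = 0)
    (hm : ∃ i ∈ I, m i ≠ 0) (h2 : ∑ i ∈ I, m i ^ 2 = 2) :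
    ∃ i ∈ I, ∃ j ∈ I, i ≠ j ∧ v i = v j := by
  obtain ⟨i, hi, j, hj, hij, hmi, hmj⟩ :=
    exists_pair_ne_zero_of_sum_mul_eq_zero (fun i hi => (hv i hi).ne') horth hm
  refine ⟨i, hi, j, hj, hij, ?_⟩
  rw [sum_eq_add_add_sum_erase (fun k => m k ^ 2) hi hj hij] at h2
  have h1 : 0 < m i ^ 2 := by positivity
  have h1' : 0 < m j ^ 2 := by positivity
  have h3 : 0 ≤ ∑ k ∈ (I.erase i).erase j, m k ^ 2 := Finset.sum_nonneg fun _ _ => sq_nonneg _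
  have hrest : ∑ k ∈ (I.erase i).erase j, m k ^ 2 = 0 := by omega
  rw [Finset.sum_eq_zero_iff_of_nonneg fun _ _ => sq_nonneg _] at hrest
  rw [sum_eq_add_add_sum_erase (fun k => v k * m k) hi hj hij,
    Finset.sum_eq_zero (s := (I.erase i).erase j) fun k hk => by
      rw [pow_eq_zero_iff two_ne_zero |>.1 (hrest k hk), mul_zero]] at horth
  have hi' := hv i hi
  have hj' := hv j hj
  rcases sq_eq_one_iff.1 (by omega : m i ^ 2 = 1) with e | e <;>
  rcases sq_eq_one_iff.1 (by omega : m j ^ 2 = 1) with e' | e' <;>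
  · rw [e, e'] at horth; omega

/-- Abel summation: the differences `N_t` telescope over the upper index range. -/
theorem sum_diff_mul_indicator {n : ℕ} {a : ℕ → ℕ} (ha1 : a 1 = 0) {i : ℕ} (hi : 1 ≤ i)
    (hin : i ≤ n + 1) :
    ∑ t ∈ Finset.Icc 1 n,
      ((a (n + 1 - t) : ℤ) - a (n + 2 - t)) * (if n + 2 ≤ i + t then 1 else 0) = -a i := by
  have key : ∀ m ≤ n, ∑ t ∈ Finset.Icc 1 m,
      ((a (n + 1 - t) : ℤ) - a (n + 2 - t)) * (if n + 2 ≤ i + t then 1 else 0)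
      = if n + 2 ≤ i + m then (a (n + 1 - m) : ℤ) - a i else 0 := by
    intro m
    induction m with
    | zero => intro _; rw [if_neg (by omega)]; simp
    | succ m ih =>
      intro hm
      rw [Finset.sum_Icc_succ_top (by omega), ih (by omega),
        show n + 2 - (m + 1) = n + 1 - m by omega]
      rcases lt_trichotomy (n + 2) (i + (m + 1)) with h | h | h
      · rw [if_pos (by omega), if_pos (by omega), if_pos (by omega)]; ring
      · rw [if_neg (by omega), if_pos (by omega), if_pos (by omega),
          show i = n + 1 - m by omega]; ring
      · rw [if_neg (by omega), if_neg (by omega), if_neg (by omega)]; ring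
  rw [key n le_rfl]
  split_ifs with h
  · simp [ha1]
  · rw [show i = 1 by omega, ha1]; simp

/-- If the coordinates `i ≠ j` of the normal vector agree, then `e_j - e_i` is a dual vector. -/
theorem dualVec_indicator_sub {n : ℕ} {a : ℕ → ℕ} (ha1 : a 1 = 0) {i j : ℕ} (hi : 1 ≤ i)
    (hij : i < j) (hjn : j ≤ n + 1) (hv : normalCoord a i = normalCoord a j) {k : ℕ}
    (hk : 1 ≤ k) (hkn : k ≤ n + 1) :
    dualVec n a (fun s => (if n + 2 ≤ j + s then 1 else 0) - (if n + 2 ≤ i + s then 1 else 0)) k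
      = (if k = j then 1 else 0) - (if k = i then 1 else 0) := by
  rcases hk.eq_or_lt with rfl | hk
  · have h1 := sum_diff_mul_indicator ha1 (n := n) hi (by omega)
    have h2 := sum_diff_mul_indicator ha1 (n := n) (i := j) (by omega) hjn
    simp only [dualVec, dualRow, if_true, sub_mul, Finset.sum_sub_distrib]
    simp only [mul_comm (ite _ _ _ : ℤ)]
    rw [h1, h2, if_neg (by omega)]
    simp only [normalCoord, if_neg (show j ≠ 1 by omega)] at hv
    rcases hi.eq_or_lt with rfl | hi
    · rw [if_pos rfl] at hv ⊢
      omega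
    · rw [if_neg (by omega)] at hv ⊢
      omega
  · rw [dualVec_of_two_le _ hk hkn]
    grind

theorem exists_dualVec_sum_sq_eq_two {n : ℕ} {a : ℕ → ℕ} (ha1 : a 1 = 0) {i j : ℕ} (hi : 1 ≤ i)
    (hij : i < j) (hjn : j ≤ n + 1) (hv : normalCoord a i = normalCoord a j) :
    ∃ δ : ℕ → ℤ, (∃ s, 1 ≤ s ∧ s ≤ n ∧ δ s ≠ 0) ∧
      ∑ k ∈ Finset.Icc 1 (n + 1), dualVec n a δ k ^ 2 = 2 := by
  refine ⟨fun s => (if n + 2 ≤ j + s then 1 else 0) - (if n + 2 ≤ i + s then 1 else 0),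
    ⟨n + 2 - j, by omega, by omega, ?_⟩, ?_⟩
  · simp only [if_pos (show n + 2 ≤ j + (n + 2 - j) by omega),
      if_neg (show ¬ n + 2 ≤ i + (n + 2 - j) by omega)]
    norm_num
  · have h : ∀ k ∈ Finset.Icc 1 (n + 1), dualVec n a
        (fun s => (if n + 2 ≤ j + s then 1 else 0) - (if n + 2 ≤ i + s then 1 else 0)) k ^ 2
        = (if k = j then 1 else 0) + (if k = i then 1 else 0) := by
      intro k hk
      rw [Finset.mem_Icc] at hk
      rw [dualVec_indicator_sub ha1 hi hij hjn hv hk.1 hk.2]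
      split_ifs <;> omega
    rw [Finset.sum_congr rfl h, Finset.sum_add_distrib, Finset.sum_ite_eq', Finset.sum_ite_eq',
      if_pos (by simp; omega), if_pos (by simp; omega)]
    norm_num

/-- The tridiagonal part of `B` acts as a second difference with Dirichlet condition at `0` and
Neumann condition at `n`. -/
theorem sum_tridiagonal_add_rankOne_mul {n : ℕ} {N : ℕ → ℝ} {B : ℕ → ℕ → ℝ}
    (hB : ∀ s t, 1 ≤ s → s ≤ n → 1 ≤ t → t ≤ n → B s t =
      if s = t then (if s = n then 1 + N n ^ 2 else 2 + N s ^ 2)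
      else if t = s + 1 ∨ s = t + 1 then -1 + N s * N t
      else N s * N t) {f : ℕ → ℝ} (hf0 : f 0 = 0) (hfn : f (n + 1) = f n)
    {s : ℕ} (hs : 1 ≤ s) (hsn : s ≤ n) :
    ∑ t ∈ Finset.Icc 1 n, B s t * f t
      = N s * ∑ t ∈ Finset.Icc 1 n, N t * f t + (2 * f s - f (s - 1) - f (s + 1)) := by
  have h : ∀ t ∈ Finset.Icc 1 n, B s t * f t = N s * (N t * f t)
      + ((if t = s then (if s = n then f t else 2 * f t) else 0) - (if t = s - 1 then f t else 0)
        - (if t = s + 1 then f t else 0)) := by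
    intro t ht
    rw [Finset.mem_Icc] at ht
    rw [hB s t hs hsn ht.1 ht.2]
    by_cases h1 : s = t
    · subst h1
      rw [if_pos rfl, if_pos rfl, if_neg (show s ≠ s - 1 by omega),
        if_neg (show s ≠ s + 1 by omega)]
      split_ifs with h2
      · subst h2; ring
      · ring
    · rw [if_neg h1, if_neg (Ne.symm h1)]
      split_ifs <;> first | omega | ring
  rw [Finset.sum_congr rfl h, Finset.sum_add_distrib, ← Finset.mul_sum, Finset.sum_sub_distrib,
    Finset.sum_sub_distrib, Finset.sum_ite_eq', Finset.sum_ite_eq', Finset.sum_ite_eq',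
    if_pos (by simp; omega)]
  congr 1
  have e1 : (if s - 1 ∈ Finset.Icc 1 n then f (s - 1) else 0) = f (s - 1) := by
    split_ifs with h1
    · rfl
    · rw [Finset.mem_Icc] at h1
      rw [show s - 1 = 0 by omega, hf0]
  rw [e1]
  rcases hsn.eq_or_lt with rfl | hlt
  · rw [if_pos rfl, if_neg (by simp), hfn]; ring
  · rw [if_neg hlt.ne, if_pos (by simp; omega)]

/-- The dual vectors are `R⁻¹` times integer vectors. -/
theorem sum_gram_mul_eq_dualRow {n : ℕ} {a : ℕ → ℕ} (ha1 : a 1 = 0) {S : ℝ}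
    (hS : S = 1 + ∑ i ∈ Finset.Icc 2 (n + 1), (a i : ℝ) ^ 2) {X : ℕ → ℝ}
    (hX : ∀ s, X s = ∑ i ∈ Finset.Icc (n + 2 - s) (n + 1), (a i : ℝ)) {N : ℕ → ℝ}
    (hN : ∀ s, 1 ≤ s → s ≤ n → N s = (a (n + 1 - s) : ℝ) - (a (n + 2 - s) : ℝ))
    {B : ℕ → ℕ → ℝ}
    (hB : ∀ s t, 1 ≤ s → s ≤ n → 1 ≤ t → t ≤ n → B s t =
      if s = t then (if s = n then 1 + N n ^ 2 else 2 + N s ^ 2)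
      else if t = s + 1 ∨ s = t + 1 then -1 + N s * N t
      else N s * N t)
    {s : ℕ} (hs : 1 ≤ s) (hsn : s ≤ n) {k : ℕ} (hk : 1 ≤ k) (hkn : k ≤ n + 1) :
    ∑ t ∈ Finset.Icc 1 n, B s t *
      ((if n + 2 ≤ k + t ∧ k ≠ 1 then 1 else 0) - normalCoord a k * X t / S)
      = dualRow n a s k := by
  have hSpos : 0 < S := by rw [hS]; positivity
  have hXstep : ∀ t ≤ n, X (t + 1) = a (n + 1 - t) + X t := by
    intro t ht
    rw [hX, hX, show n + 2 - (t + 1) = n + 1 - t by omega,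
      ← Finset.add_sum_Ioc_eq_sum_Icc (show n + 1 - t ≤ n + 1 by omega)]
    congr 2
    ext i; simp; omega
  have hX0 : X 0 = 0 := by rw [hX]; simp
  have hXn : X (n + 1) = X n := by rw [hXstep n le_rfl]; simp [ha1]
  have hNsum : ∀ i, 1 ≤ i → i ≤ n + 1 →
      ∑ t ∈ Finset.Icc 1 n, N t * (if n + 2 ≤ i + t then 1 else 0) = -(a i : ℝ) := by
    intro i h1 h2
    have h := congrArg (Int.cast : ℤ → ℝ) (sum_diff_mul_indicator ha1 h1 h2)
    push_cast at h
    rw [← h]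
    refine Finset.sum_congr rfl fun t ht => ?_
    rw [Finset.mem_Icc] at ht
    rw [hN t ht.1 ht.2]
  have hNX : ∑ t ∈ Finset.Icc 1 n, N t * X t = 1 - S := by
    have hXt : ∀ t ∈ Finset.Icc 1 n, N t * X t
        = ∑ i ∈ Finset.Icc 2 (n + 1), a i * (N t * (if n + 2 ≤ i + t then 1 else 0)) := by
      intro t ht
      rw [Finset.mem_Icc] at ht
      rw [hX, Finset.mul_sum]
      simp only [mul_ite, mul_one, mul_zero]
      rw [← Finset.sum_filter]
      refine Finset.sum_congr ?_ fun _ _ => mul_comm _ _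
      ext i; simp; omega
    rw [Finset.sum_congr rfl hXt, Finset.sum_comm, hS, ← sub_sub, sub_self, zero_sub,
      ← Finset.sum_neg_distrib]
    refine Finset.sum_congr rfl fun i hi => ?_
    rw [Finset.mem_Icc] at hi
    rw [← Finset.mul_sum, hNsum i (by omega) hi.2]; ring
  rw [sum_tridiagonal_add_rankOne_mul hB
    (f := fun t => (if n + 2 ≤ k + t ∧ k ≠ 1 then 1 else 0) - normalCoord a k * X t / S)
    (by simp only [hX0]; rw [if_neg (by omega)]; simp)
    (by simp only [hXn]; congr 1; exact if_congr (by omega) rfl rfl) hs hsn]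
  have hXs : 2 * X s - X (s - 1) - X (s + 1) = -N s := by
    have h1 := hXstep (s - 1) (by omega)
    rw [show s - 1 + 1 = s by omega, show n + 1 - (s - 1) = n + 2 - s by omega] at h1
    rw [hXstep s hsn, hN s hs hsn]; linarith
  have hNf : ∑ t ∈ Finset.Icc 1 n, N t *
      ((if n + 2 ≤ k + t ∧ k ≠ 1 then 1 else 0) - normalCoord a k * X t / S)
      = -(a k : ℝ) - normalCoord a k / S * (1 - S) := by
    rw [← hNX, ← hNsum k hk hkn, Finset.mul_sum, ← Finset.sum_sub_distrib]
    refine Finset.sum_congr rfl fun t ht => ?_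
    rw [Finset.mem_Icc] at ht
    have : (n + 2 ≤ k + t ∧ k ≠ 1) = (n + 2 ≤ k + t) := propext (by omega)
    simp only [this]
    ring
  rw [hNf]
  have hX' : X (s + 1) = 2 * X s - X (s - 1) + N s := by linarith
  simp only [hX']
  rcases hk.eq_or_lt with rfl | hk
  · simp [normalCoord, dualRow, ha1, ← hN s hs hsn]
    field_simp
    ring
  · have hind : (2 * (if n + 2 ≤ k + s ∧ k ≠ 1 then 1 else 0)
        - (if n + 2 ≤ k + (s - 1) ∧ k ≠ 1 then 1 else 0)
        - (if n + 2 ≤ k + (s + 1) ∧ k ≠ 1 then 1 else 0) : ℝ) = dualRow n a s k := by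
      simp only [dualRow, if_neg (show k ≠ 1 by omega)]
      push_cast
      split_ifs <;> first | omega | norm_num
    rw [← hind]
    simp only [normalCoord, if_neg (show k ≠ 1 by omega)]
    field_simp
    ring



/-- Every nonzero element `y = ∑ δ_s·A*_s` (`δ ∈ ℤⁿ`, `δ ≠ 0`) of the dual
lattice `Γ*` satisfies `‖y‖² ≥ 2/R²`; moreover, the minimum of `‖y‖²` over nonzero `y ∈ Γ*`
equals `2/R²` if and only if at least two components of `(1, a₂, …, a_{n+1})` are equal. -/
theorem dual_lattice_minimum
    (n : ℕ) (hn : 1 ≤ n)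
    (a : ℕ → ℕ) (ha1 : a 1 = 0)
    (hapos : ∀ i, 2 ≤ i → i ≤ n + 1 → 0 < a i)
    (R : ℝ) (hR : 0 < R)
    (S : ℝ) (hS : S = 1 + ∑ i ∈ Finset.Icc 2 (n + 1), (a i : ℝ) ^ 2)
    (X : ℕ → ℝ) (hX : ∀ s, X s = ∑ i ∈ Finset.Icc (n + 2 - s) (n + 1), (a i : ℝ))
    (N : ℕ → ℝ) (hN : ∀ s, 1 ≤ s → s ≤ n → N s = (a (n + 1 - s) : ℝ) - (a (n + 2 - s) : ℝ))
    (A : ℕ → Fin (n + 1) → ℝ)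
    (hA : ∀ s, 1 ≤ s → s ≤ n → ∀ j : Fin (n + 1),
      A s j =
        if (j : ℕ) + 1 = 1 then R / S * (-X s)
        else if (j : ℕ) + 1 ≤ n + 1 - s then R / S * (-(a ((j : ℕ) + 1) : ℝ) * X s)
        else R / S * (S - (a ((j : ℕ) + 1) : ℝ) * X s))
    (B : ℕ → ℕ → ℝ)
    (hB : ∀ s t, 1 ≤ s → s ≤ n → 1 ≤ t → t ≤ n → B s t =
      if s = t then (if s = n then 1 + N n ^ 2 else 2 + N s ^ 2)
      else if t = s + 1 ∨ s = t + 1 then -1 + N s * N t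
      else N s * N t)
    (Astar : ℕ → Fin (n + 1) → ℝ)
    (hAstar : ∀ s, 1 ≤ s → s ≤ n →
      Astar s = (R ^ 2)⁻¹ • ∑ t ∈ Finset.Icc 1 n, B s t • A t) :
    (∀ δ : ℕ → ℤ, (∃ s, 1 ≤ s ∧ s ≤ n ∧ δ s ≠ 0) →
        2 / R ^ 2 ≤ ∑ j : Fin (n + 1), ((∑ s ∈ Finset.Icc 1 n, (δ s : ℝ) • Astar s) j) ^ 2) ∧
      ((∃ δ : ℕ → ℤ, (∃ s, 1 ≤ s ∧ s ≤ n ∧ δ s ≠ 0) ∧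
          ∑ j : Fin (n + 1), ((∑ s ∈ Finset.Icc 1 n, (δ s : ℝ) • Astar s) j) ^ 2 = 2 / R ^ 2) ↔
        ((∃ i, 2 ≤ i ∧ i ≤ n + 1 ∧ a i = 1) ∨
          (∃ i j, 2 ≤ i ∧ i < j ∧ j ≤ n + 1 ∧ a i = a j))) := by
  have hSpos : 0 < S := by rw [hS]; positivity
  have hstar : ∀ s, 1 ≤ s → s ≤ n → ∀ j : Fin (n + 1),
      Astar s j = R⁻¹ * dualRow n a s ((j : ℕ) + 1) := by
    intro s hs hsn j
    rw [← sum_gram_mul_eq_dualRow ha1 hS hX hN hB hs hsn (k := (j : ℕ) + 1) (by omega) (by omega),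
      hAstar s hs hsn, Pi.smul_apply, Finset.sum_apply, smul_eq_mul, Finset.mul_sum,
      Finset.mul_sum]
    refine Finset.sum_congr rfl fun t ht => ?_
    rw [Finset.mem_Icc] at ht
    rw [Pi.smul_apply, smul_eq_mul, hA t ht.1 ht.2 j]
    simp only [normalCoord]
    split_ifs <;> first | omega | (push_cast; field_simp; try ring)
  have hsq : ∀ δ : ℕ → ℤ,
      ∑ j : Fin (n + 1), ((∑ s ∈ Finset.Icc 1 n, (δ s : ℝ) • Astar s) j) ^ 2
        = ((∑ k ∈ Finset.Icc 1 (n + 1), dualVec n a δ k ^ 2 : ℤ) : ℝ) / R ^ 2 := by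
    intro δ
    rw [← sum_fin_succ_eq_sum_Icc n fun k => dualVec n a δ k ^ 2]
    push_cast
    rw [Finset.sum_div]
    refine Finset.sum_congr rfl fun j _ => ?_
    rw [← div_pow, Finset.sum_apply, dualVec]
    push_cast
    rw [Finset.sum_div]
    congr 1
    refine Finset.sum_congr rfl fun s hs => ?_
    rw [Finset.mem_Icc] at hs
    rw [Pi.smul_apply, smul_eq_mul, hstar s hs.1 hs.2]
    ring
  have hpos : ∀ k ∈ Finset.Icc 1 (n + 1), (0 : ℤ) < normalCoord a k := by
    intro k hk
    rw [Finset.mem_Icc] at hk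
    rw [normalCoord]
    split_ifs
    · norm_num
    · exact_mod_cast hapos k (by omega) hk.2
  have hiff : ((∃ i, 2 ≤ i ∧ i ≤ n + 1 ∧ a i = 1) ∨
      (∃ i j, 2 ≤ i ∧ i < j ∧ j ≤ n + 1 ∧ a i = a j)) ↔
      ∃ i j, 1 ≤ i ∧ i < j ∧ j ≤ n + 1 ∧ normalCoord a i = normalCoord a j := by
    constructor
    · rintro (⟨i, hi, hin, h⟩ | ⟨i, j, hi, hij, hj, h⟩)
      · exact ⟨1, i, le_rfl, hi, hin, by simp [normalCoord, h]⟩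
      · refine ⟨i, j, by omega, hij, hj, ?_⟩
        rw [normalCoord, normalCoord, if_neg (by omega), if_neg (by omega), h]
    · rintro ⟨i, j, hi, hij, hj, h⟩
      rw [normalCoord, normalCoord, if_neg (show j ≠ 1 by omega)] at h
      split_ifs at h with h1
      · exact Or.inl ⟨j, by omega, hj, h.symm⟩
      · exact Or.inr ⟨i, j, by omega, hij, hj, h⟩
  have hR2 : 0 < R ^ 2 := by positivity
  refine ⟨fun δ hδ => ?_, ?_⟩
  · rw [hsq, div_le_div_iff_of_pos_right hR2]
    exact_mod_cast two_le_sum_sq_of_orthogonal (fun i hi => (hpos i hi).ne')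
      (dualVec_orthogonal ha1 δ) (exists_dualVec_ne_zero hδ)
  · rw [hiff]
    constructor
    · rintro ⟨δ, hδ, h⟩
      rw [hsq, div_left_inj' hR2.ne'] at h
      obtain ⟨i, hi, j, hj, hij, hv⟩ := exists_eq_of_sum_sq_eq_two hpos
        (dualVec_orthogonal ha1 δ) (exists_dualVec_ne_zero hδ) (by exact_mod_cast h)
      rw [Finset.mem_Icc] at hi hj
      rcases hij.lt_or_gt with hlt | hlt
      · exact ⟨i, j, hi.1, hlt, hj.2, by exact_mod_cast hv⟩
      · exact ⟨j, i, hj.1, hlt, hi.2, by exact_mod_cast hv.symm⟩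
    · rintro ⟨i, j, hi, hij, hj, hv⟩
      obtain ⟨δ, hδ, h⟩ := exists_dualVec_sum_sq_eq_two ha1 hi hij hj hv
      refine ⟨δ, hδ, ?_⟩
      rw [hsq, h]
      norm_num
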